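/- arXiv:1706.01527 — 2 statements merged into one kernel-verified Lean document; each statement's English description precedes it below -/
import Mathlib

section
/- Let F : [0,∞) → [0,∞) be a non-increasing, right-continuous function with lim_{s→∞} F(s) = 0. Suppose there exist constants α > 0 and A > 0 such that for all s > 0 and all r with 0 ≤ r ≤ 1 one has r·F(s+r) ≤ A·(F(s))^{1+α}. Then there exists S ≥ 0, depending only on α, A, and the smallest s₀ ≥ 0 satisfying (F(s₀))^α ≤ (2A)^{-1}, such that F(s) = 0 for all s ≥ S. -/
/-- De Giorgi-type iteration lemma (Lemma 3.4): if `F : [0,∞) → [0,∞)` is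
non-increasing, right-continuous, tends to `0` at infinity, and satisfies
`r * F (s + r) ≤ A * (F s) ^ (1 + α)` for all `s > 0` and `0 ≤ r ≤ 1`, then `F`
vanishes beyond some threshold `S` depending only on `α`, `A` and the smallest
`s₀ ≥ 0` with `(F s₀) ^ α ≤ (2 * A)⁻¹`. -/
theorem stmt_0 (α A : ℝ) (hα : 0 < α) (hA : 0 < A) :
    ∃ S : ℝ → ℝ, ∀ (F : ℝ → ℝ) (s₀ : ℝ),
      (∀ s, 0 ≤ s → 0 ≤ F s) →
      (AntitoneOn F (Set.Ici (0 : ℝ))) →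
      (∀ s, 0 ≤ s → ContinuousWithinAt F (Set.Ici s) s) →
      Filter.Tendsto F Filter.atTop (nhds 0) →
      (∀ s, 0 < s → ∀ r, 0 ≤ r → r ≤ 1 → r * F (s + r) ≤ A * (F s) ^ (1 + α)) →
      IsLeast {s : ℝ | 0 ≤ s ∧ (F s) ^ α ≤ (2 * A)⁻¹} s₀ →
      0 ≤ S s₀ ∧ ∀ s, S s₀ ≤ s → F s = 0 := by
  set q : ℝ := (1 / 2 : ℝ) ^ α with hq
  have hq0 : 0 < q := by positivity
  have hq1 : q < 1 := Real.rpow_lt_one (by norm_num) (by norm_num) hα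
  have h1q : 0 < 1 - q := by linarith
  refine ⟨fun s₀ => s₀ + 1 + (1 - q)⁻¹, ?_⟩
  intro F s₀ hF hanti _ _ hrec hleast
  obtain ⟨⟨hs0, hs1⟩, _⟩ := hleast
  refine ⟨by positivity, ?_⟩
  intro s hs
  simp only at hs
  have ht0 : ∀ n : ℕ, 0 ≤ ∑ i ∈ Finset.range n, q ^ i := fun n => by positivity
  have ht1 : ∀ n : ℕ, ∑ i ∈ Finset.range n, q ^ i ≤ (1 - q)⁻¹ := fun n => by
    rw [← tsum_geometric_of_lt_one hq0.le hq1]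
    exact (summable_geometric_of_lt_one hq0.le hq1).sum_le_tsum _ (fun i _ => by positivity)
  have key : ∀ n : ℕ, (F (s₀ + 1 + ∑ i ∈ Finset.range n, q ^ i)) ^ α ≤ q ^ n * (2 * A)⁻¹ := by
    intro n
    induction n with
    | zero =>
      simp only [Finset.range_zero, Finset.sum_empty, add_zero, pow_zero, one_mul]
      refine le_trans (Real.rpow_le_rpow (hF _ (by linarith)) ?_ hα.le) hs1
      exact hanti (by simpa using hs0) (Set.mem_Ici.2 (by linarith)) (by linarith)
    | succ n ih =>
      have hn := ht0 n
      have hqn : 0 < q ^ n := by positivity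
      have hr := hrec (s₀ + 1 + ∑ i ∈ Finset.range n, q ^ i) (by linarith) (q ^ n) hqn.le
        (pow_le_one₀ hq0.le hq1.le)
      have hf0 := hF (s₀ + 1 + ∑ i ∈ Finset.range n, q ^ i) (by linarith)
      have hf1 := hF (s₀ + 1 + ∑ i ∈ Finset.range (n + 1), q ^ i) (by linarith [ht0 (n + 1)])
      rw [Finset.sum_range_succ, ← add_assoc] at hf1 ⊢
      generalize F (s₀ + 1 + ∑ i ∈ Finset.range n, q ^ i + q ^ n) = y at *
      generalize F (s₀ + 1 + ∑ i ∈ Finset.range n, q ^ i) = x at *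
      rw [Real.rpow_add_of_nonneg hf0 zero_le_one hα.le, Real.rpow_one] at hr
      have h2 : q ^ n * y ≤ q ^ n * (1 / 2 * x) := by
        calc q ^ n * y ≤ A * (x * x ^ α) := hr
          _ ≤ A * (x * (q ^ n * (2 * A)⁻¹)) := by gcongr
          _ = q ^ n * (1 / 2 * x) := by field_simp
      have h3 : y ≤ 1 / 2 * x := le_of_mul_le_mul_left h2 hqn
      calc y ^ α ≤ (1 / 2 * x) ^ α := Real.rpow_le_rpow hf1 h3 hα.le
        _ = q * x ^ α := by rw [Real.mul_rpow (by norm_num) hf0]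
        _ ≤ q * (q ^ n * (2 * A)⁻¹) := by gcongr
        _ = q ^ (n + 1) * (2 * A)⁻¹ := by ring
  have hinv : 0 < (1 - q)⁻¹ := by positivity
  have hFs := hF s (by linarith)
  have hle : ∀ n : ℕ, (F s) ^ α ≤ q ^ n * (2 * A)⁻¹ := fun n => by
    refine le_trans (Real.rpow_le_rpow hFs ?_ hα.le) (key n)
    exact hanti (Set.mem_Ici.2 (by linarith [ht0 n])) (Set.mem_Ici.2 (by linarith))
      (by linarith [ht1 n])
  have hlim : Filter.Tendsto (fun n : ℕ => q ^ n * (2 * A)⁻¹) Filter.atTop (nhds 0) := by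
    simpa using (tendsto_pow_atTop_nhds_zero_of_lt_one hq0.le hq1).mul_const ((2 * A)⁻¹)
  have hz : (F s) ^ α ≤ 0 := ge_of_tendsto' hlim hle
  by_contra hne
  have hpos : 0 < F s := lt_of_le_of_ne hFs (Ne.symm hne)
  exact absurd hz (not_le.2 (Real.rpow_pos_of_pos hpos α))
end

section
/- Let C ≥ 0, r > 0 and a ∈ ℝ, and let f : ℝ → ℝ be twice differentiable on the interval [a − r, a + r]. Suppose that f''(x) ≤ C for all x ∈ [a − r, a + r], and that |f(x) − f(y)| ≤ r² for all x, y ∈ [a − r, a + r]. Then |f'(a)| ≤ (1 + C)·r. -/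
/-- Quantitative mean-value argument (Section 5): if `f'' ≤ C` on `[a-r, a+r]`
and the oscillation of `f` on `[a-r, a+r]` is at most `r²`, then `|f'(a)| ≤ (1+C) r`. -/
theorem stmt_4 (C r a : ℝ) (hC : 0 ≤ C) (hr : 0 < r) (f : ℝ → ℝ)
    (hf : ∀ x ∈ Set.Icc (a - r) (a + r), DifferentiableAt ℝ f x)
    (hf' : ∀ x ∈ Set.Icc (a - r) (a + r), DifferentiableAt ℝ (deriv f) x)
    (hC' : ∀ x ∈ Set.Icc (a - r) (a + r), deriv (deriv f) x ≤ C)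
    (hosc : ∀ x ∈ Set.Icc (a - r) (a + r), ∀ y ∈ Set.Icc (a - r) (a + r),
      |f x - f y| ≤ r ^ 2) :
    |deriv f a| ≤ (1 + C) * r := by
  have key : ∀ g : ℝ → ℝ, (∀ x ∈ Set.Icc (a - r) (a + r), DifferentiableAt ℝ g x) →
      ∀ u v : ℝ, a - r ≤ u → u < v → v ≤ a + r →
      ∃ c, u < c ∧ c < v ∧ deriv g c * (v - u) = g v - g u := by
    intro g hg u v hu huv hv
    obtain ⟨c, hc, h⟩ := exists_deriv_eq_slope g huv
      (fun x hx => (hg x ⟨hu.trans hx.1, hx.2.trans hv⟩).continuousAt.continuousWithinAt)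
      (fun x hx => (hg x ⟨hu.trans hx.1.le, hx.2.le.trans hv⟩).differentiableWithinAt)
    refine ⟨c, hc.1, hc.2, ?_⟩
    rw [h, div_mul_cancel₀]
    linarith
  have slope : ∀ u v : ℝ, a - r ≤ u → u < v → v ≤ a + r → v - u ≤ r →
      deriv f v - deriv f u ≤ C * r := by
    intro u v hu huv hv hvu
    obtain ⟨d, h1, h2, h⟩ := key (deriv f) hf' u v hu huv hv
    rw [← h]
    have hd := hC' d ⟨by linarith, by linarith⟩
    exact (mul_le_mul_of_nonneg_right hd (by linarith)).trans
      (mul_le_mul_of_nonneg_left hvu hC)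
  have ha : a ∈ Set.Icc (a - r) (a + r) := ⟨by linarith, by linarith⟩
  rw [abs_le]
  constructor
  · obtain ⟨c, h1, h2, h⟩ := key f hf a (a + r) (by linarith) (by linarith) le_rfl
    have ho := (abs_le.1 (hosc (a + r) ⟨by linarith, le_rfl⟩ a ha)).1
    have hs := slope a c (by linarith) h1 h2.le (by linarith)
    have hc : -r ≤ deriv f c := le_of_mul_le_mul_right (by nlinarith) hr
    linarith
  · obtain ⟨c, h1, h2, h⟩ := key f hf (a - r) a le_rfl (by linarith) (by linarith)
    have ho := (abs_le.1 (hosc a ha (a - r) ⟨le_rfl, by linarith⟩)).2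
    have hs := slope c a h1.le h2 (by linarith) (by linarith)
    have hc : deriv f c ≤ r := le_of_mul_le_mul_right (by nlinarith) hr
    linarith
end
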